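/- Let n₁, n₂, n₃, n₄ be four points of ℙ²(ℂ), no three of which are collinear, and let P be the pencil of conics passing through all four points. Let L be a line containing none of the four points. Then exactly two members of the pencil P intersect L in exactly one point (i.e., exactly two members of P are tangent to L). -/

import Mathlib

open MvPolynomial

noncomputable section

abbrev P2 : Type := Projectivization ℂ (Fin 3 → ℂ)

/-- The zero locus in `ℙ²` of a polynomial `F`: the points all of whose
representative vectors are zeros of `F`. -/
def curve (F : MvPolynomial (Fin 3) ℂ) : Set P2 :=
  {p | ∀ (w : Fin 3 → ℂ) (hw : w ≠ 0), Projectivization.mk ℂ w hw = p → eval w F = 0}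

/-- The projective line spanned by two vectors. -/
def lineThrough (u v : Fin 3 → ℂ) : Set P2 :=
  {p | ∃ s t : ℂ, ∃ h : s • u + t • v ≠ 0, p = Projectivization.mk ℂ (s • u + t • v) h}

/-- A subset of `ℙ²` is a line if it is the projective span of two
linearly independent vectors. -/
def IsLine (S : Set P2) : Prop :=
  ∃ u v : Fin 3 → ℂ, LinearIndependent ℂ ![u, v] ∧ S = lineThrough u v

/-- The restriction of `F` to the affine parametrization `t ↦ a + t • b` of the line
through `[a]` and `[b]`, as a polynomial in `t`. -/
def lineRest (F : MvPolynomial (Fin 3) ℂ) (a b : Fin 3 → ℂ) : Polynomial ℂ :=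
  eval₂ Polynomial.C (fun i => Polynomial.C (a i) + Polynomial.X * Polynomial.C (b i)) F

/-- The local intersection multiplicity, at the point `[a]`, of the curve `F = 0` with the
line through `[a]` and `[b]` (parametrized by `t ↦ a + t • b`, the point `[a]`
corresponding to `t = 0`). -/
def multAt (F : MvPolynomial (Fin 3) ℂ) (a b : Fin 3 → ℂ) : ℕ :=
  Polynomial.rootMultiplicity 0 (lineRest F a b)

/-- The scheme `X ∩ L` (for `X = {F = 0}`, `L` a line) is everywhere nonreduced: at each
point of `X ∩ L` the local intersection multiplicity is at least `2`.  (Stated over all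
parametrizations of `L`; the base point `a` of a parametrization is a point of `L`, and
every point of `L` occurs as such a base point.) -/
def EverywhereTangent (F : MvPolynomial (Fin 3) ℂ) (S : Set P2) : Prop :=
  ∀ a b : Fin 3 → ℂ, LinearIndependent ℂ ![a, b] → S = lineThrough a b →
    ∀ ha : a ≠ 0, Projectivization.mk ℂ a ha ∈ curve F → 2 ≤ multAt F a b

/-- A theta-line of the quartic `F`: either contained in the curve, or intersecting it
everywhere nonreducedly. -/
def ThetaLine (F : MvPolynomial (Fin 3) ℂ) (S : Set P2) : Prop :=
  IsLine S ∧ (S ⊆ curve F ∨ EverywhereTangent F S)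

/-- A bitangent line of (a smooth curve) `F = 0`: a line, not contained in the curve,
whose scheme-theoretic intersection with the curve is everywhere nonreduced. -/
def Bitangent (F : MvPolynomial (Fin 3) ℂ) (S : Set P2) : Prop :=
  IsLine S ∧ ¬ S ⊆ curve F ∧ EverywhereTangent F S

/-- The line `S` is tangent to the curve `F = 0` at the point `q`: the local intersection
multiplicity there is at least `2`. -/
def TangentAt (F : MvPolynomial (Fin 3) ℂ) (S : Set P2) (q : P2) : Prop :=
  IsLine S ∧ q ∈ S ∧ q ∈ curve F ∧
    ∀ a b : Fin 3 → ℂ, LinearIndependent ℂ ![a, b] → S = lineThrough a b →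
      ∀ ha : a ≠ 0, Projectivization.mk ℂ a ha = q → 2 ≤ multAt F a b

/-- The curve `F = 0` is smooth: `F` and its partial derivatives have no common
projective zero. -/
def SmoothCurve (F : MvPolynomial (Fin 3) ℂ) : Prop :=
  ∀ w : Fin 3 → ℂ, w ≠ 0 → ¬ (eval w F = 0 ∧ ∀ i : Fin 3, eval w (pderiv i F) = 0)

/-- Iterated partial derivative along a list of coordinate directions. -/
def pderivList (l : List (Fin 3)) (F : MvPolynomial (Fin 3) ℂ) : MvPolynomial (Fin 3) ℂ :=
  l.foldr (fun i G => pderiv i G) F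

/-- `F` vanishes to order at least `m` at the point `p` (all partial derivatives of
order `< m` vanish at `p`); i.e. `p` is a point of multiplicity at least `m` of `F = 0`. -/
def VanishesToOrder (F : MvPolynomial (Fin 3) ℂ) (p : P2) (m : ℕ) : Prop :=
  ∀ l : List (Fin 3), l.length < m →
    ∀ (w : Fin 3 → ℂ) (hw : w ≠ 0), Projectivization.mk ℂ w hw = p →
      eval w (pderivList l F) = 0

/-- `p` is a singular point of the curve `F = 0`. -/
def IsSingularAt (F : MvPolynomial (Fin 3) ℂ) (p : P2) : Prop :=
  VanishesToOrder F p 2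

/-- `p` is a double point: a point of multiplicity exactly `2`. -/
def IsDoublePoint (F : MvPolynomial (Fin 3) ℂ) (p : P2) : Prop :=
  VanishesToOrder F p 2 ∧ ¬ VanishesToOrder F p 3

/-- The quadratic form (in the direction `b`) cutting out the tangent cone of `F = 0`
at the double point `[a]`: the degree-`2` Taylor coefficient of `t ↦ F (a + t • b)`. -/
def coneCoeff (F : MvPolynomial (Fin 3) ℂ) (a b : Fin 3 → ℂ) : ℂ :=
  (lineRest F a b).coeff 2

/-- `p` is an ordinary node: a double point whose tangent cone consists of two distinct
lines, i.e. the tangent-cone quadratic has two null directions independent modulo `a`. -/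
def OrdinaryNode (F : MvPolynomial (Fin 3) ℂ) (p : P2) : Prop :=
  IsDoublePoint F p ∧
    ∀ (a : Fin 3 → ℂ) (ha : a ≠ 0), Projectivization.mk ℂ a ha = p →
      ∃ b₁ b₂ : Fin 3 → ℂ, LinearIndependent ℂ ![a, b₁, b₂] ∧
        coneCoeff F a b₁ = 0 ∧ coneCoeff F a b₂ = 0

/-- At the double point `[a]`, the tangent cone is the double line through `[a]` and
`[b₀]`: `b₀` is a null direction of the tangent-cone quadratic, and every null
direction lies on the line spanned by `a` and `b₀`. -/
def DoubleLineCone (F : MvPolynomial (Fin 3) ℂ) (a b₀ : Fin 3 → ℂ) : Prop :=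
  LinearIndependent ℂ ![a, b₀] ∧ coneCoeff F a b₀ = 0 ∧
    ∀ b : Fin 3 → ℂ, coneCoeff F a b = 0 → b ∈ Submodule.span ℂ ({a, b₀} : Set (Fin 3 → ℂ))

/-- `p` is an ordinary cusp: a double point whose tangent cone is a double line `L₀`
with local intersection multiplicity `i(L₀ · X) = 3` at `p`. -/
def OrdinaryCusp (F : MvPolynomial (Fin 3) ℂ) (p : P2) : Prop :=
  IsDoublePoint F p ∧
    ∀ (a : Fin 3 → ℂ) (ha : a ≠ 0), Projectivization.mk ℂ a ha = p →
      ∃ b₀ : Fin 3 → ℂ, DoubleLineCone F a b₀ ∧ multAt F a b₀ = 3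

/-- `p` is an ordinary tacnode: a double point whose tangent cone is a double line `L₀`
with local intersection multiplicity `i(L₀ · X) = 4` at `p`. -/
def OrdinaryTacnode (F : MvPolynomial (Fin 3) ℂ) (p : P2) : Prop :=
  IsDoublePoint F p ∧
    ∀ (a : Fin 3 → ℂ) (ha : a ≠ 0), Projectivization.mk ℂ a ha = p →
      ∃ b₀ : Fin 3 → ℂ, DoubleLineCone F a b₀ ∧ multAt F a b₀ = 4

/-- A theta-line of type `i`: a theta-line, not a component of the curve, containing
exactly `i` singular points of the curve. -/
def ThetaLineOfType (F : MvPolynomial (Fin 3) ℂ) (i : ℕ) (S : Set P2) : Prop :=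
  ThetaLine F S ∧ ¬ S ⊆ curve F ∧ {p | p ∈ S ∧ IsSingularAt F p}.ncard = i

/-- Three points of `ℙ²` are collinear. -/
def Collin (p q r : P2) : Prop :=
  ∃ S : Set P2, IsLine S ∧ p ∈ S ∧ q ∈ S ∧ r ∈ S


/-- An ordinary bitangent: a bitangent meeting the curve at exactly two distinct points,
each with local intersection multiplicity exactly `2`. -/
def OrdinaryBitangent (F : MvPolynomial (Fin 3) ℂ) (S : Set P2) : Prop :=
  Bitangent F S ∧ (S ∩ curve F).ncard = 2 ∧
    ∀ a b : Fin 3 → ℂ, LinearIndependent ℂ ![a, b] → S = lineThrough a b →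
      ∀ ha : a ≠ 0, Projectivization.mk ℂ a ha ∈ curve F → multAt F a b = 2

/-- A bitangent meeting the curve only at smooth points. -/
def SmoothBitangent (F : MvPolynomial (Fin 3) ℂ) (S : Set P2) : Prop :=
  Bitangent F S ∧ ∀ p ∈ S ∩ curve F, ¬ IsSingularAt F p

theorem mk_mem_lineThrough_iff {u v w : Fin 3 → ℂ} (hw : w ≠ 0) :
    Projectivization.mk ℂ w hw ∈ lineThrough u v ↔ w ∈ Submodule.span ℂ {u, v} := by
  rw [Submodule.mem_span_pair]
  constructor
  · rintro ⟨s, t, h, e⟩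
    obtain ⟨c, hc⟩ := (Projectivization.mk_eq_mk_iff' ℂ _ _ _ _).1 e
    exact ⟨c * s, c * t, by rw [← hc, smul_add, smul_smul, smul_smul]⟩
  · rintro ⟨s, t, rfl⟩
    exact ⟨s, t, hw, rfl⟩

theorem IsLine.exists_dual {S : Set P2} (hS : IsLine S) :
    ∃ φ : Module.Dual ℂ (Fin 3 → ℂ), ∀ w (hw : w ≠ 0),
      Projectivization.mk ℂ w hw ∈ S ↔ φ w = 0 := by
  obtain ⟨u, v, huv, rfl⟩ := hS
  refine ⟨(dotProductBilin ℂ ℂ).flip (crossProduct u v), fun w hw => ?_⟩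
  rw [mk_mem_lineThrough_iff]
  change _ ↔ w ⬝ᵥ _ = 0
  rw [triple_product_eq_det]
  have h1 := Matrix.linearIndependent_rows_iff_isUnit (A := Matrix.of ![w, u, v])
  have h2 : LinearIndependent ℂ (Matrix.of ![w, u, v]).row ↔ _ :=
    linearIndependent_finCons (x := w) (v := ![u, v])
  rw [h1, Matrix.isUnit_iff_isUnit_det, isUnit_iff_ne_zero] at h2
  have h3 : Set.range ![u, v] = {u, v} := by simp [Set.pair_comm]
  rw [h3] at h2
  change (Matrix.det ![w, u, v] ≠ 0) ↔ _ at h2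
  tauto

theorem isLine_setOf_dual {φ : Module.Dual ℂ (Fin 3 → ℂ)} (hφ : φ ≠ 0) :
    ∃ S, IsLine S ∧ ∀ w (hw : w ≠ 0), φ w = 0 → Projectivization.mk ℂ w hw ∈ S := by
  have h := Module.Dual.finrank_ker_add_one_of_ne_zero hφ
  have h2 : Module.finrank ℂ (LinearMap.ker φ) = 2 := by simpa using h
  let b := Module.finBasisOfFinrankEq ℂ _ h2
  refine ⟨_, ⟨b 0, b 1, ?_, rfl⟩, fun w hw h0 => ?_⟩
  · have := b.linearIndependent.map' (LinearMap.ker φ).subtype (Submodule.ker_subtype _)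
    have h3 : ![(b 0 : Fin 3 → ℂ), (b 1 : Fin 3 → ℂ)] = (LinearMap.ker φ).subtype ∘ b := by
      ext i
      fin_cases i <;> rfl
    rwa [h3]
  · have := b.sum_repr ⟨w, h0⟩
    rw [mk_mem_lineThrough_iff, Submodule.mem_span_pair]
    rw [Fin.sum_univ_two] at this
    exact ⟨b.repr ⟨w, h0⟩ 0, b.repr ⟨w, h0⟩ 1, congrArg Subtype.val this⟩

theorem linearIndependent_of_not_collin {u v w : Fin 3 → ℂ} (hu : u ≠ 0) (hv : v ≠ 0)
    (hw : w ≠ 0)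
    (h : ¬ Collin (Projectivization.mk ℂ u hu) (Projectivization.mk ℂ v hv)
      (Projectivization.mk ℂ w hw)) : LinearIndependent ℂ ![u, v, w] := by
  by_contra hli
  apply h
  have h1 := Matrix.linearIndependent_rows_iff_isUnit (A := Matrix.of ![u, v, w])
  change LinearIndependent ℂ ![u, v, w] ↔ _ at h1
  rw [h1, Matrix.isUnit_iff_isUnit_det, isUnit_iff_ne_zero, not_not,
    ← Matrix.exists_mulVec_eq_zero_iff] at hli
  obtain ⟨l, hl, h0⟩ := hli
  have hφ : (dotProductBilin ℂ ℂ).flip l ≠ 0 := by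
    intro h
    exact hl (dotProduct_eq_zero l fun x => by
      rw [dotProduct_comm]; exact LinearMap.congr_fun h x)
  obtain ⟨S, hS, hm⟩ := isLine_setOf_dual hφ
  exact ⟨S, hS, hm _ _ (congrFun h0 0), hm _ _ (congrFun h0 1), hm _ _ (congrFun h0 2)⟩

theorem exists_isHomogeneous_of_dual (φ : Module.Dual ℂ (Fin 3 → ℂ)) :
    ∃ l : MvPolynomial (Fin 3) ℂ, l.IsHomogeneous 1 ∧ ∀ w, eval w l = φ w := by
  refine ⟨∑ i, C (φ (Pi.single i 1)) * X i, ?_, fun w => ?_⟩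
  · exact IsHomogeneous.sum _ _ _ fun i _ => isHomogeneous_C_mul_X _ _
  · conv_rhs => rw [LinearMap.pi_apply_eq_sum_univ φ w]
    simp only [map_sum, map_mul, eval_C, eval_X, smul_eq_mul]
    refine Finset.sum_congr rfl fun i _ => ?_
    rw [mul_comm]
    congr 2
    ext j
    simp [Pi.single_apply, eq_comm]

theorem MvPolynomial.IsHomogeneous.exists_eval_eq_quadratic {Q : MvPolynomial (Fin 3) ℂ}
    (hQ : Q.IsHomogeneous 2) :
    ∃ A B D a b c : ℂ, ∀ w, eval w Q = A * w 0 ^ 2 + B * w 1 ^ 2 + D * w 2 ^ 2 +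
      a * (w 1 * w 2) + b * (w 0 * w 2) + c * (w 0 * w 1) := by
  rw [Q.as_sum]
  refine Finset.sum_induction _ (fun P : MvPolynomial (Fin 3) ℂ => ∃ A B D a b c : ℂ,
    ∀ w, eval w P = A * w 0 ^ 2 + B * w 1 ^ 2 + D * w 2 ^ 2 +
      a * (w 1 * w 2) + b * (w 0 * w 2) + c * (w 0 * w 1)) ?_ ?_ ?_
  · rintro P P' ⟨A, B, D, a, b, c, h⟩ ⟨A', B', D', a', b', c', h'⟩
    refine ⟨A + A', B + B', D + D', a + a', b + b', c + c', fun w => ?_⟩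
    rw [map_add, h, h']
    ring
  · exact ⟨0, 0, 0, 0, 0, 0, fun w => by simp⟩
  · intro d hd
    have h := hQ.degree_eq_sum_deg_support hd
    rw [← Finsupp.degree_apply, Finsupp.degree_eq_sum, Fin.sum_univ_three] at h
    generalize coeff d Q = k
    simp only [eval_monomial, Finsupp.prod_fintype _ _ (fun i => pow_zero _), Fin.prod_univ_three]
    generalize d 0 = i at *
    generalize d 1 = j at *
    generalize d 2 = l at *
    have : (i = 2 ∧ j = 0 ∧ l = 0) ∨ (i = 0 ∧ j = 2 ∧ l = 0) ∨ (i = 0 ∧ j = 0 ∧ l = 2) ∨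
      (i = 0 ∧ j = 1 ∧ l = 1) ∨ (i = 1 ∧ j = 0 ∧ l = 1) ∨ (i = 1 ∧ j = 1 ∧ l = 0) := by omega
    rcases this with ⟨rfl, rfl, rfl⟩ | ⟨rfl, rfl, rfl⟩ | ⟨rfl, rfl, rfl⟩ | ⟨rfl, rfl, rfl⟩ |
      ⟨rfl, rfl, rfl⟩ | ⟨rfl, rfl, rfl⟩
    · exact ⟨k, 0, 0, 0, 0, 0, fun w => by ring⟩
    · exact ⟨0, k, 0, 0, 0, 0, fun w => by ring⟩
    · exact ⟨0, 0, k, 0, 0, 0, fun w => by ring⟩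
    · exact ⟨0, 0, 0, k, 0, 0, fun w => by ring⟩
    · exact ⟨0, 0, 0, 0, k, 0, fun w => by ring⟩
    · exact ⟨0, 0, 0, 0, 0, k, fun w => by ring⟩

theorem MvPolynomial.IsHomogeneous.exists_eval_eq_quadratic_repr
    {Q : MvPolynomial (Fin 3) ℂ} (hQ : Q.IsHomogeneous 2)
    (e : Module.Basis (Fin 3) ℂ (Fin 3 → ℂ)) :
    ∃ A B D a b c : ℂ, ∀ w, eval w Q = A * e.repr w 0 ^ 2 + B * e.repr w 1 ^ 2 +
      D * e.repr w 2 ^ 2 + a * (e.repr w 1 * e.repr w 2) + b * (e.repr w 0 * e.repr w 2) +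
      c * (e.repr w 0 * e.repr w 1) := by
  choose l hl hle using fun i => exists_isHomogeneous_of_dual
    (LinearMap.proj i ∘ₗ (e.equivFun.symm : (Fin 3 → ℂ) →ₗ[ℂ] (Fin 3 → ℂ)))
  have hP : (bind₁ l Q).IsHomogeneous 2 := by simpa using hQ.aeval l hl
  obtain ⟨A, B, D, a, b, c, h⟩ := hP.exists_eval_eq_quadratic
  refine ⟨A, B, D, a, b, c, fun w => ?_⟩
  have h1 := h (e.equivFun w)
  rw [eval, eval₂Hom_bind₁] at h1
  change eval (fun i => eval (e.equivFun w) (l i)) Q = _ at h1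
  refine Eq.trans ?_ h1
  congr 2
  funext i
  rw [hle]
  exact (congrFun (e.equivFun.symm_apply_apply w) i).symm

theorem mk_mem_curve_iff {Q : MvPolynomial (Fin 3) ℂ} (hQ : Q.IsHomogeneous 2)
    {w : Fin 3 → ℂ} (hw : w ≠ 0) :
    Projectivization.mk ℂ w hw ∈ curve Q ↔ eval w Q = 0 := by
  refine ⟨fun h => h w hw rfl, fun h u hu hmk => ?_⟩
  obtain ⟨c, rfl⟩ := (Projectivization.mk_eq_mk_iff' ℂ _ _ _ _).1 hmk
  obtain ⟨A, B, D, a, b, d, hq⟩ := hQ.exists_eval_eq_quadratic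
  rw [hq] at h ⊢
  simp only [Pi.smul_apply, smul_eq_mul]
  linear_combination c ^ 2 * h

theorem exists_basis_of_not_collin {n₁ n₂ n₃ n₄ : P2}
    (h123 : ¬ Collin n₁ n₂ n₃) (h124 : ¬ Collin n₁ n₂ n₄)
    (h134 : ¬ Collin n₁ n₃ n₄) (h234 : ¬ Collin n₂ n₃ n₄) :
    ∃ (e : Module.Basis (Fin 3) ℂ (Fin 3 → ℂ)) (h : e 0 + e 1 + e 2 ≠ 0),
      n₁ = Projectivization.mk ℂ (e 0) (e.ne_zero 0) ∧
      n₂ = Projectivization.mk ℂ (e 1) (e.ne_zero 1) ∧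
      n₃ = Projectivization.mk ℂ (e 2) (e.ne_zero 2) ∧
      n₄ = Projectivization.mk ℂ (e 0 + e 1 + e 2) h := by
  induction n₁ using Projectivization.ind with | h v₁ hv₁
  induction n₂ using Projectivization.ind with | h v₂ hv₂
  induction n₃ using Projectivization.ind with | h v₃ hv₃
  induction n₄ using Projectivization.ind with | h v₄ hv₄
  have l123 := linearIndependent_of_not_collin _ _ _ h123
  have l124 := linearIndependent_of_not_collin _ _ _ h124
  have l134 := linearIndependent_of_not_collin _ _ _ h134
  have l234 := linearIndependent_of_not_collin _ _ _ h234
  let f := basisOfLinearIndependentOfCardEqFinrank l123 (by simp)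
  have hf : ∀ i, f i = ![v₁, v₂, v₃] i := fun i => by simp [f]
  have hf0 : f 0 = v₁ := hf 0
  have hf1 : f 1 = v₂ := hf 1
  have hf2 : f 2 = v₃ := hf 2
  have hv := f.sum_repr v₄
  set c := f.repr v₄
  rw [Fin.sum_univ_three, hf0, hf1, hf2] at hv
  have h0 : c 0 ≠ 0 := by
    intro h
    have := Fintype.linearIndependent_iff.1 l234 ![c 1, c 2, -1]
      (by simp [Fin.sum_univ_three, ← hv, h]; abel) 2
    simp at this
  have h1 : c 1 ≠ 0 := by
    intro h
    have := Fintype.linearIndependent_iff.1 l134 ![c 0, c 2, -1]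
      (by simp [Fin.sum_univ_three, ← hv, h]; abel) 2
    simp at this
  have h2 : c 2 ≠ 0 := by
    intro h
    have := Fintype.linearIndependent_iff.1 l124 ![c 0, c 1, -1]
      (by simp [Fin.sum_univ_three, ← hv, h]; abel) 2
    simp at this
  have hc : ∀ i, IsUnit (c i) := fun i => by
    rw [isUnit_iff_ne_zero]
    fin_cases i <;> assumption
  have he0 : f.isUnitSMul hc 0 = c 0 • v₁ := by rw [Module.Basis.isUnitSMul_apply, hf0]
  have he1 : f.isUnitSMul hc 1 = c 1 • v₂ := by rw [Module.Basis.isUnitSMul_apply, hf1]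
  have he2 : f.isUnitSMul hc 2 = c 2 • v₃ := by rw [Module.Basis.isUnitSMul_apply, hf2]
  refine ⟨f.isUnitSMul hc, by rwa [he0, he1, he2, hv], ?_, ?_, ?_, ?_⟩
  · exact ((Projectivization.mk_eq_mk_iff' ℂ _ _ _ _).2 ⟨c 0, he0.symm⟩).symm
  · exact ((Projectivization.mk_eq_mk_iff' ℂ _ _ _ _).2 ⟨c 1, he1.symm⟩).symm
  · exact ((Projectivization.mk_eq_mk_iff' ℂ _ _ _ _).2 ⟨c 2, he2.symm⟩).symm
  · exact (Projectivization.mk_eq_mk_iff' ℂ _ _ _ _).2 ⟨1, by rw [he0, he1, he2, hv, one_smul]⟩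

/-- Every binary quadratic form over `ℂ` is a product of two linear forms. -/
theorem exists_binary_quadratic_factorization (P M R : ℂ) :
    ∃ p₁ q₁ p₂ q₂ : ℂ, P = p₁ * p₂ ∧ M = p₁ * q₂ + p₂ * q₁ ∧ R = q₁ * q₂ := by
  by_cases hP : P = 0
  · exact ⟨0, 1, M, R, by simp [hP], by ring, by ring⟩
  · obtain ⟨s, hs⟩ := IsAlgClosed.exists_pow_nat_eq (M ^ 2 - 4 * P * R) (n := 2) two_pos
    refine ⟨P, (M + s) / 2, 1, (M - s) / (2 * P), by ring, ?_, ?_⟩ <;> field_simp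
    · ring
    · linear_combination hs

theorem exists_mul_of_linear_eq_zero {p q x y : ℂ} (hpq : ¬ (p = 0 ∧ q = 0))
    (h : p * x + q * y = 0) : ∃ c, x = c * q ∧ y = c * -p := by
  by_cases hq : q = 0
  · have hp : p ≠ 0 := fun hp => hpq ⟨hp, hq⟩
    subst hq
    refine ⟨-y / p, ?_, by field_simp⟩
    simpa [hp] using h
  · refine ⟨x / q, by field_simp, ?_⟩
    field_simp
    linear_combination h

theorem exists_pencil_member (e : Module.Basis (Fin 3) ℂ (Fin 3 → ℂ)) (a b : ℂ) :
    ∃ Q : MvPolynomial (Fin 3) ℂ, Q.IsHomogeneous 2 ∧ ∀ w, eval w Q =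
      a * (e.repr w 1 * e.repr w 2 - e.repr w 0 * e.repr w 1) +
      b * (e.repr w 0 * e.repr w 2 - e.repr w 0 * e.repr w 1) := by
  choose l hl hle using fun i => exists_isHomogeneous_of_dual (e.coord i)
  refine ⟨C a * (l 1 * l 2 - l 0 * l 1) + C b * (l 0 * l 2 - l 0 * l 1), ?_, fun w => ?_⟩
  · exact ((((hl 1).mul (hl 2)).sub ((hl 0).mul (hl 1))).C_mul a).add
      ((((hl 0).mul (hl 2)).sub ((hl 0).mul (hl 1))).C_mul b)
  · simp [hle]

/-- In coordinates in which the four base points are the coordinate points and `(1 : 1 : 1)`,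
a conic through them has the form `a (yz - xy) + b (xz - xy)`. -/
theorem exists_eval_eq_of_mem_curve {Q : MvPolynomial (Fin 3) ℂ} (hQ : Q.IsHomogeneous 2)
    (e : Module.Basis (Fin 3) ℂ (Fin 3 → ℂ)) (h0 : eval (e 0) Q = 0) (h1 : eval (e 1) Q = 0)
    (h2 : eval (e 2) Q = 0) (h : eval (e 0 + e 1 + e 2) Q = 0) :
    ∃ a b : ℂ, ∀ w, eval w Q =
      a * (e.repr w 1 * e.repr w 2 - e.repr w 0 * e.repr w 1) +
      b * (e.repr w 0 * e.repr w 2 - e.repr w 0 * e.repr w 1) := by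
  obtain ⟨A, B, D, a, b, c, hq⟩ := hQ.exists_eval_eq_quadratic_repr e
  rw [hq] at h0 h1 h2 h
  simp at h0 h1 h2 h
  subst h0 h1 h2
  refine ⟨a, b, fun w => ?_⟩
  rw [hq]
  linear_combination (e.repr w 0 * e.repr w 1) * h

theorem existsUnique_mem_curve_inter_iff {Q : MvPolynomial (Fin 3) ℂ} (hQ : Q.IsHomogeneous 2)
    (e : Module.Basis (Fin 3) ℂ (Fin 3 → ℂ)) {a b : ℂ} (hab : ¬ (a = 0 ∧ b = 0))
    (hq : ∀ w, eval w Q = a * (e.repr w 1 * e.repr w 2 - e.repr w 0 * e.repr w 1) +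
      b * (e.repr w 0 * e.repr w 2 - e.repr w 0 * e.repr w 1))
    {L : Set P2} {φ : Module.Dual ℂ (Fin 3 → ℂ)}
    (hL : ∀ w (hw : w ≠ 0), Projectivization.mk ℂ w hw ∈ L ↔ φ w = 0)
    {α β γ : ℂ} (hφ : ∀ w, φ w = α * e.repr w 0 + β * e.repr w 1 + γ * e.repr w 2)
    (hα : α ≠ 0) (hβ : β ≠ 0) (hγ : γ ≠ 0) :
    (∃! p, p ∈ curve Q ∩ L) ↔
      (a * α + b * β + (a + b) * γ) ^ 2 - 4 * (a * b * (α * β)) = 0 := by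
  obtain ⟨p₁, q₁, p₂, q₂, hP, hM, hR⟩ := exists_binary_quadratic_factorization
    (b * α) (a * α + b * β + (a + b) * γ) (a * β)
  have hab' : ¬ (a * β = 0 ∧ b * α = 0) := by simpa [hα, hβ] using hab
  have hpq₁ : ¬ (p₁ = 0 ∧ q₁ = 0) := by
    rintro ⟨rfl, rfl⟩
    exact hab' ⟨by simp [hR], by simp [hP]⟩
  have hpq₂ : ¬ (p₂ = 0 ∧ q₂ = 0) := by
    rintro ⟨rfl, rfl⟩
    exact hab' ⟨by simp [hR], by simp [hP]⟩
  let Φ : ℂ → ℂ → Fin 3 → ℂ := fun x y => e.equivFun.symm ![γ * x, γ * y, -(α * x + β * y)]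
  have hΦ0 : ∀ x y, e.repr (Φ x y) 0 = γ * x := fun x y => by
    rw [← e.equivFun_apply, LinearEquiv.apply_symm_apply]; rfl
  have hΦ1 : ∀ x y, e.repr (Φ x y) 1 = γ * y := fun x y => by
    rw [← e.equivFun_apply, LinearEquiv.apply_symm_apply]; rfl
  have hΦ2 : ∀ x y, e.repr (Φ x y) 2 = -(α * x + β * y) := fun x y => by
    rw [← e.equivFun_apply, LinearEquiv.apply_symm_apply]; rfl
  have hΦφ : ∀ x y, φ (Φ x y) = 0 := fun x y => by
    rw [hφ, hΦ0, hΦ1, hΦ2]; ring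
  have hΦQ : ∀ x y, eval (Φ x y) Q = -γ * ((p₁ * x + q₁ * y) * (p₂ * x + q₂ * y)) := fun x y => by
    rw [hq, hΦ0, hΦ1, hΦ2]
    linear_combination (-γ * x ^ 2) * hP - γ * x * y * hM - γ * y ^ 2 * hR
  have hΦ : ∀ {p q : ℂ}, ¬ (p = 0 ∧ q = 0) → Φ q (-p) ≠ 0 := fun {p q} h h0 => h (by
    have h1 := hΦ0 q (-p)
    have h2 := hΦ1 q (-p)
    rw [h0] at h1 h2
    simp [hγ] at h1 h2
    exact ⟨h2, h1⟩)
  have ext_repr : ∀ u w : Fin 3 → ℂ, e.repr u 0 = e.repr w 0 → e.repr u 1 = e.repr w 1 →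
      e.repr u 2 = e.repr w 2 → u = w := fun u w h0 h1 h2 => by
    apply e.repr.injective
    ext i
    fin_cases i <;> assumption
  have key : ∀ {p q : ℂ} (h : ¬ (p = 0 ∧ q = 0)) (w : Fin 3 → ℂ) (hw : w ≠ 0), φ w = 0 →
      (p * e.repr w 0 + q * e.repr w 1 = 0 ↔
        Projectivization.mk ℂ w hw = Projectivization.mk ℂ (Φ q (-p)) (hΦ h)) := by
    intro p q h w hw hw0
    rw [Projectivization.mk_eq_mk_iff']
    constructor
    · intro h0
      obtain ⟨c, hx, hy⟩ := exists_mul_of_linear_eq_zero h h0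
      refine ⟨c / γ, ext_repr _ _ ?_ ?_ ?_⟩
      · simp [hΦ0, hx]
        field_simp
      · simp [hΦ1, hy]
        field_simp
      · rw [hφ, hx, hy] at hw0
        simp [hΦ2]
        field_simp
        linear_combination -hw0
    · rintro ⟨c, rfl⟩
      simp [hΦ0, hΦ1]
      ring
  have hmem : ∀ p, p ∈ curve Q ∩ L ↔ p = Projectivization.mk ℂ _ (hΦ hpq₁) ∨
      p = Projectivization.mk ℂ _ (hΦ hpq₂) := by
    intro p
    induction p using Projectivization.ind with | h w hw
    rw [Set.mem_inter_iff, mk_mem_curve_iff hQ, hL]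
    constructor
    · rintro ⟨h1, h2⟩
      rw [← key hpq₁ w hw h2, ← key hpq₂ w hw h2, ← mul_eq_zero]
      have h3 : γ • w = Φ (e.repr w 0) (e.repr w 1) := by
        apply ext_repr
        · simp [hΦ0]
        · simp [hΦ1]
        · rw [hφ] at h2
          simp [hΦ2]
          linear_combination h2
      have h4 := hΦQ (e.repr w 0) (e.repr w 1)
      rw [← h3, hq] at h4
      rw [hq] at h1
      simp only [map_smul, Finsupp.smul_apply, smul_eq_mul] at h4
      have h5 : γ * ((p₁ * e.repr w 0 + q₁ * e.repr w 1) *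
          (p₂ * e.repr w 0 + q₂ * e.repr w 1)) = 0 := by
        linear_combination h4 - γ ^ 2 * h1
      exact (mul_eq_zero.1 h5).resolve_left hγ
    · have aux : ∀ {p q : ℂ} (h : ¬ (p = 0 ∧ q = 0)), eval (Φ q (-p)) Q = 0 →
          Projectivization.mk ℂ w hw = Projectivization.mk ℂ (Φ q (-p)) (hΦ h) →
          eval w Q = 0 ∧ φ w = 0 := by
        intro p q h h0 he
        rw [← mk_mem_curve_iff hQ hw, ← hL w hw, he, mk_mem_curve_iff hQ, hL]
        exact ⟨h0, hΦφ _ _⟩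
      rintro (h | h)
      · exact aux hpq₁ (by rw [hΦQ]; ring) h
      · exact aux hpq₂ (by rw [hΦQ]; ring) h
  have huniq : (∃! p, p ∈ curve Q ∩ L) ↔
      Projectivization.mk ℂ _ (hΦ hpq₂) = Projectivization.mk ℂ _ (hΦ hpq₁) := by
    simp only [hmem]
    constructor
    · rintro ⟨p, -, h⟩
      rw [h _ (Or.inl rfl), h _ (Or.inr rfl)]
    · intro h
      exact ⟨_, Or.inl rfl, by rintro p (rfl | rfl) <;> simp [h]⟩
  rw [huniq, ← key hpq₁ _ _ (hΦφ _ _), hΦ0, hΦ1]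
  have h1 : p₁ * (γ * q₂) + q₁ * (γ * -p₂) = γ * (p₁ * q₂ - p₂ * q₁) := by ring
  have h2 : (a * α + b * β + (a + b) * γ) ^ 2 - 4 * (a * b * (α * β)) =
      (p₁ * q₂ - p₂ * q₁) ^ 2 := by
    rw [hM]
    linear_combination (-4 * a * β) * hP - 4 * p₁ * p₂ * hR
  rw [h1, h2]
  simp [hγ]

theorem curve_congr {P Q : MvPolynomial (Fin 3) ℂ}
    (h : ∀ w, eval w P = 0 ↔ eval w Q = 0) : curve P = curve Q := by
  simp only [curve, h]

/-- Given four points of `ℙ²`, no three collinear, and a line `L`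
containing none of them, exactly two conics through the four points (i.e. two members of
the pencil they determine) intersect `L` in exactly one point. -/
theorem pencil_two_tangent_members
    (n₁ n₂ n₃ n₄ : P2)
    (h123 : ¬ Collin n₁ n₂ n₃) (h124 : ¬ Collin n₁ n₂ n₄)
    (h134 : ¬ Collin n₁ n₃ n₄) (h234 : ¬ Collin n₂ n₃ n₄)
    (L : Set P2) (hL : IsLine L)
    (hn₁ : n₁ ∉ L) (hn₂ : n₂ ∉ L) (hn₃ : n₃ ∉ L) (hn₄ : n₄ ∉ L) :
    {C : Set P2 |
      (∃ Q : MvPolynomial (Fin 3) ℂ, Q ≠ 0 ∧ Q.IsHomogeneous 2 ∧ C = curve Q) ∧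
      n₁ ∈ C ∧ n₂ ∈ C ∧ n₃ ∈ C ∧ n₄ ∈ C ∧ (∃! p : P2, p ∈ C ∩ L)}.ncard = 2 := by
  obtain ⟨φ, hL'⟩ := hL.exists_dual
  obtain ⟨e, he, rfl, rfl, rfl, rfl⟩ := exists_basis_of_not_collin h123 h124 h134 h234
  rw [hL'] at hn₁ hn₂ hn₃ hn₄
  rw [map_add, map_add] at hn₄
  have hφ : ∀ w, φ w = φ (e 0) * e.repr w 0 + φ (e 1) * e.repr w 1 + φ (e 2) * e.repr w 2 := by
    intro w
    conv_lhs => rw [← e.sum_repr w]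
    simp only [Fin.sum_univ_three, map_add, map_smul, smul_eq_mul]
    ring
  generalize φ (e 0) = α at *
  generalize φ (e 1) = β at *
  generalize φ (e 2) = γ at *
  obtain ⟨p₁, q₁, p₂, q₂, hP, hM, hR⟩ := exists_binary_quadratic_factorization
    ((α + γ) ^ 2) (2 * ((α + γ) * (β + γ)) - 4 * (α * β)) ((β + γ) ^ 2)
  have hdisc : ∀ a b, (a * α + b * β + (a + b) * γ) ^ 2 - 4 * (a * b * (α * β)) =
      (p₁ * a + q₁ * b) * (p₂ * a + q₂ * b) := fun a b => by
    linear_combination a ^ 2 * hP + a * b * hM + b ^ 2 * hR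
  have hne : p₁ * q₂ - p₂ * q₁ ≠ 0 := by
    intro h
    have : α * β * γ * (α + β + γ) = 0 := by
      linear_combination (-(p₁ * q₂ - p₂ * q₁) / 16) * h +
        (-(2 * ((α + γ) * (β + γ)) - 4 * (α * β) + p₁ * q₂ + p₂ * q₁) / 16) * hM +
        ((β + γ) ^ 2 / 4) * hP + (p₁ * p₂ / 4) * hR
    simp_all
  have hpq₁ : ¬ (p₁ = 0 ∧ q₁ = 0) := by
    rintro ⟨rfl, rfl⟩
    simp at hne
  have hpq₂ : ¬ (p₂ = 0 ∧ q₂ = 0) := by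
    rintro ⟨rfl, rfl⟩
    simp at hne
  obtain ⟨Q₁, hQ₁, hq₁⟩ := exists_pencil_member e q₁ (-p₁)
  obtain ⟨Q₂, hQ₂, hq₂⟩ := exists_pencil_member e q₂ (-p₂)
  have hmem : ∀ {p q : ℂ} {Q : MvPolynomial (Fin 3) ℂ}, ¬ (p = 0 ∧ q = 0) → Q.IsHomogeneous 2 →
      (∀ w, eval w Q = q * (e.repr w 1 * e.repr w 2 - e.repr w 0 * e.repr w 1) +
        -p * (e.repr w 0 * e.repr w 2 - e.repr w 0 * e.repr w 1)) →
      (p₁ * q + q₁ * -p) * (p₂ * q + q₂ * -p) = 0 →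
      Q ≠ 0 ∧ Projectivization.mk ℂ (e 0) (e.ne_zero 0) ∈ curve Q ∧
        Projectivization.mk ℂ (e 1) (e.ne_zero 1) ∈ curve Q ∧
        Projectivization.mk ℂ (e 2) (e.ne_zero 2) ∈ curve Q ∧
        Projectivization.mk ℂ (e 0 + e 1 + e 2) he ∈ curve Q ∧ ∃! x, x ∈ curve Q ∩ L := by
    intro p q Q hpq hQ hq h0
    simp only [mk_mem_curve_iff hQ]
    refine ⟨?_, by simp [hq], by simp [hq], by simp [hq], by simp [hq], ?_⟩
    · rintro rfl
      have h1 := hq (e 1 + e 2)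
      have h2 := hq (e 0 + e 2)
      simp at h1 h2
      exact hpq ⟨h2, h1.symm⟩
    · rw [existsUnique_mem_curve_inter_iff hQ e (by rwa [neg_eq_zero, and_comm]) hq hL' hφ
        hn₁ hn₂ hn₃, hdisc, h0]
  obtain ⟨hQ₁0, h₁⟩ := hmem hpq₁ hQ₁ hq₁ (by ring)
  obtain ⟨hQ₂0, h₂⟩ := hmem hpq₂ hQ₂ hq₂ (by ring)
  rw [Set.ncard_eq_two]
  refine ⟨curve Q₁, curve Q₂, ?_, ?_⟩
  · intro heq
    obtain ⟨x, ⟨hx₁, hxL⟩, -⟩ := h₁.2.2.2.2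
    have hx₂ := heq ▸ hx₁
    induction x using Projectivization.ind with | h w hw
    rw [mk_mem_curve_iff hQ₁, hq₁] at hx₁
    rw [mk_mem_curve_iff hQ₂, hq₂] at hx₂
    rw [hL', hφ] at hxL
    apply hw
    apply e.repr.injective
    generalize e.repr w = c at *
    have hU : c 1 * (c 2 - c 0) = 0 := by
      refine (mul_eq_zero.1 ?_).resolve_left hne
      linear_combination p₁ * hx₂ - p₂ * hx₁
    have hV : c 0 * (c 2 - c 1) = 0 := by
      refine (mul_eq_zero.1 ?_).resolve_left hne
      linear_combination q₁ * hx₂ - q₂ * hx₁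
    have hc : c 0 = 0 ∧ c 1 = 0 ∧ c 2 = 0 := by
      rcases mul_eq_zero.1 hU with h1 | h1 <;> rcases mul_eq_zero.1 hV with h0 | h0
      · simp_all
      · simp_all
      · simp_all
      · have h2 : c 0 = c 2 := by linear_combination -h1
        have h3 : c 1 = c 2 := by linear_combination -h0
        have h4 : (α + β + γ) * c 2 = 0 := by
          linear_combination hxL - α * h2 - β * h3
        simp_all
    ext i
    fin_cases i
    exacts [by simpa using hc.1, by simpa using hc.2.1, by simpa using hc.2.2]
  · ext K
    simp only [Set.mem_ofPred_eq, Set.mem_insert_iff, Set.mem_singleton_iff]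
    constructor
    · rintro ⟨⟨Q, hQ0, hQ, rfl⟩, k₁, k₂, k₃, k₄, hu⟩
      rw [mk_mem_curve_iff hQ] at k₁ k₂ k₃ k₄
      obtain ⟨a, b, hq⟩ := exists_eval_eq_of_mem_curve hQ e k₁ k₂ k₃ k₄
      have hab : ¬ (a = 0 ∧ b = 0) := by
        rintro ⟨rfl, rfl⟩
        exact hQ0 (MvPolynomial.funext fun w => by simp [hq])
      rw [existsUnique_mem_curve_inter_iff hQ e hab hq hL' hφ hn₁ hn₂ hn₃, hdisc,
        mul_eq_zero] at hu
      have aux : ∀ {p q : ℂ} {P : MvPolynomial (Fin 3) ℂ}, ¬ (p = 0 ∧ q = 0) →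
          (∀ w, eval w P = q * (e.repr w 1 * e.repr w 2 - e.repr w 0 * e.repr w 1) +
            -p * (e.repr w 0 * e.repr w 2 - e.repr w 0 * e.repr w 1)) →
          p * a + q * b = 0 → curve Q = curve P := by
        intro p q P hpq hP h0
        obtain ⟨c, rfl, rfl⟩ := exists_mul_of_linear_eq_zero hpq h0
        have hc : c ≠ 0 := by
          rintro rfl
          simp at hab
        refine curve_congr fun w => ?_
        have : eval w Q = c * eval w P := by
          rw [hq, hP]
          ring
        simp [this, hc]
      exact hu.imp (aux hpq₁ hq₁) (aux hpq₂ hq₂)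
    · rintro (rfl | rfl)
      · exact ⟨⟨Q₁, hQ₁0, hQ₁, rfl⟩, h₁⟩
      · exact ⟨⟨Q₂, hQ₂0, hQ₂, rfl⟩, h₂⟩

end
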